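/- Let θ1 = φ1∘λ with φ1 symmetric convex piecewise affine, X̄ ∈ Sⁿ and Ȳ ∈ ∂θ1(X̄). Then for any S ∈ ∂Pr_{θ1}(X̄+Ȳ) (Clarke's generalized Jacobian of the proximal mapping) and any pair (ΔX, ΔY) ∈ Sⁿ×Sⁿ satisfying ΔX = S(ΔX + ΔY), one has ⟨ΔX, ΔY⟩ ≥ −Υ¹_{X̄}(Ȳ, ΔX), where Υ¹_{X̄}(Ȳ,H) := 2 ∑_{l=1}^{r} ⟨ Λ(Ȳ)_{α^l α^l}, Ūᵀ_{α^l} H (X̄ − v̄_l I)† H Ū_{α^l} ⟩ for Ū ∈ 𝕆ⁿ(X̄) ∩ 𝕆ⁿ(Ȳ). -/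

import Mathlib

open Matrix Filter Topology Set
open scoped Classical

noncomputable section

/-- The vector of eigenvalues of a symmetric matrix, in non-increasing order. -/
noncomputable def lamVec {n : ℕ} (X : Matrix (Fin n) (Fin n) ℝ) : Fin n → ℝ :=
  if h : X.IsHermitian then fun i => (h.eigenvalues ∘ Tuple.sort h.eigenvalues) i.rev else 0

/-- The set `𝕆ⁿ(X)` of orthogonal matrices giving an ordered eigenvalue decomposition of `X`. -/
def OSet {n : ℕ} (X : Matrix (Fin n) (Fin n) ℝ) : Set (Matrix (Fin n) (Fin n) ℝ) :=
  {U | Uᵀ * U = 1 ∧ X = U * Matrix.diagonal (lamVec X) * Uᵀ}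

/-- One-sided directional derivative of a scalar function. -/
noncomputable def dirDeriv {E : Type*} [AddCommMonoid E] [Module ℝ E] (f : E → ℝ) (x h : E) : ℝ :=
  limUnder (𝓝[>] (0:ℝ)) fun t => (f (x + t • h) - f x) / t

/-- Vector of one-sided directional derivatives of the ordered eigenvalues: `λ'(X;H)`. -/
noncomputable def lamDD {n : ℕ} (X H : Matrix (Fin n) (Fin n) ℝ) : Fin n → ℝ :=
  fun i => dirDeriv (fun Y => lamVec Y i) X H

/-- The max-of-affine convex piecewise affine function `φ(x) = max_i (⟨aⁱ,x⟩ - cᵢ)`. -/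
noncomputable def pwa {n p : ℕ} [NeZero p] (a : Fin p → Fin n → ℝ) (c : Fin p → ℝ)
    (x : Fin n → ℝ) : ℝ :=
  ⨆ i, (a i ⬝ᵥ x - c i)

/-- The active index set `ι(x̄)` of a max-of-affine function at `x̄`. -/
def iotaA {n p : ℕ} [NeZero p] (a : Fin p → Fin n → ℝ) (c : Fin p → ℝ)
    (x : Fin n → ℝ) : Set (Fin p) :=
  {i | a i ⬝ᵥ x - c i = pwa a c x}

/-- Frobenius inner product of two matrices. -/
def mip {n : ℕ} (A B : Matrix (Fin n) (Fin n) ℝ) : ℝ := (Aᵀ * B).trace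

/-- Convex subdifferential (over the space of symmetric matrices) of a real function. -/
def msubdiff {n : ℕ} (f : Matrix (Fin n) (Fin n) ℝ → ℝ) (X : Matrix (Fin n) (Fin n) ℝ) :
    Set (Matrix (Fin n) (Fin n) ℝ) :=
  {G | G.IsSymm ∧ ∀ Y : Matrix (Fin n) (Fin n) ℝ, Y.IsSymm → f X + mip G (Y - X) ≤ f Y}

/-- Moore–Penrose pseudo-inverse, via the four Penrose conditions. -/
noncomputable def mpInv {n : ℕ} (A : Matrix (Fin n) (Fin n) ℝ) : Matrix (Fin n) (Fin n) ℝ :=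
  Classical.epsilon fun B => A * B * A = A ∧ B * A * B = B ∧ (A * B)ᵀ = A * B ∧ (B * A)ᵀ = B * A

/-- The sigma-term function
`Υ_X(Y,H) = 2 ∑_l ⟨Λ(Y)_{αˡαˡ}, Uᵀ_{αˡ} H (X - v̄ₗ I)† H U_{αˡ}⟩` (written as a single sum
over eigenvalue indices). -/
noncomputable def Upsilon {n : ℕ} (X Y U H : Matrix (Fin n) (Fin n) ℝ) : ℝ :=
  2 * ∑ i, lamVec Y i *
    ((Uᵀ * H * mpInv (X - lamVec X i • (1 : Matrix (Fin n) (Fin n) ℝ)) * H * U) i i)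

/-- Proximal point of a real function on the space of symmetric matrices. -/
noncomputable def proxM {n : ℕ} (f : Matrix (Fin n) (Fin n) ℝ → ℝ)
    (X : Matrix (Fin n) (Fin n) ℝ) : Matrix (Fin n) (Fin n) ℝ :=
  Classical.epsilon fun W => W.IsSymm ∧ ∀ U : Matrix (Fin n) (Fin n) ℝ, U.IsSymm →
    f W + mip (W - X) (W - X) / 2 ≤ f U + mip (U - X) (U - X) / 2

/-- Metric projection onto a subset of matrix space. -/
noncomputable def projM {n : ℕ} (K : Set (Matrix (Fin n) (Fin n) ℝ))
    (X : Matrix (Fin n) (Fin n) ℝ) : Matrix (Fin n) (Fin n) ℝ :=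
  Classical.epsilon fun W => W ∈ K ∧ ∀ U ∈ K, mip (W - X) (W - X) ≤ mip (U - X) (U - X)

attribute [local instance] Matrix.normedAddCommGroup Matrix.normedSpace

/-- Clarke's generalized Jacobian of a (locally Lipschitz) map between normed spaces:  the
convex hull of all limits of Jacobians along sequences of points of differentiability. -/
def clarkeJacobian {E F : Type*} [NormedAddCommGroup E] [NormedSpace ℝ E]
    [NormedAddCommGroup F] [NormedSpace ℝ F] (G : E → F) (x : E) : Set (E →L[ℝ] F) :=
  convexHull ℝ {L : E →L[ℝ] F | ∃ u : ℕ → E, (∀ k, DifferentiableAt ℝ G (u k)) ∧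
    Filter.Tendsto u Filter.atTop (𝓝 x) ∧
    Filter.Tendsto (fun k => fderiv ℝ G (u k)) Filter.atTop (𝓝 L)}


lemma isHerm_of_symm {n : ℕ} {X : Matrix (Fin n) (Fin n) ℝ} (h : X.IsSymm) : X.IsHermitian := by
  unfold Matrix.IsHermitian
  rw [Matrix.conjTranspose_eq_transpose_of_trivial]
  exact h

lemma lamVec_conj {n : ℕ} (R X : Matrix (Fin n) (Fin n) ℝ) (hR : Rᵀ * R = 1) (hX : X.IsSymm) :
    lamVec (R * X * Rᵀ) = lamVec X := by
  have hX' : (R * X * Rᵀ).IsSymm := by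
    unfold Matrix.IsSymm
    rw [Matrix.transpose_mul, Matrix.transpose_mul, hX.eq, Matrix.transpose_transpose,
      Matrix.mul_assoc]
  have h1 := isHerm_of_symm hX
  have h2 := isHerm_of_symm hX'
  have h3 : h2.eigenvalues = h1.eigenvalues := by
    rw [Matrix.IsHermitian.eigenvalues_eq_eigenvalues_iff, Matrix.charpoly_mul_comm,
      ← Matrix.mul_assoc, hR, Matrix.one_mul]
  unfold lamVec
  rw [dif_pos h1, dif_pos h2, h3]

lemma lamVec_antitone {n : ℕ} (X : Matrix (Fin n) (Fin n) ℝ) : Antitone (lamVec X) := by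
  unfold lamVec
  split_ifs with h
  · intro i j hij
    exact Tuple.monotone_sort h.eigenvalues (Fin.rev_le_rev.mpr hij)
  · intro i j _
    simp

lemma OSet_nonempty {n : ℕ} (X : Matrix (Fin n) (Fin n) ℝ) (hX : X.IsSymm) :
    ∃ U, U ∈ OSet X := by
  have h := isHerm_of_symm hX
  let V : Matrix (Fin n) (Fin n) ℝ := h.eigenvectorUnitary
  have hV1 : Vᵀ * V = 1 := by
    have := Unitary.coe_star_mul_self h.eigenvectorUnitary
    rwa [Matrix.star_eq_conjTranspose, Matrix.conjTranspose_eq_transpose_of_trivial] at this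
  have hV2 : X = V * Matrix.diagonal h.eigenvalues * Vᵀ := by
    have := h.spectral_theorem
    rw [Unitary.conjStarAlgAut_apply] at this
    rw [Matrix.star_eq_conjTranspose, Matrix.conjTranspose_eq_transpose_of_trivial] at this
    exact this
  let τ : Equiv.Perm (Fin n) := Fin.revPerm.trans (Tuple.sort h.eigenvalues)
  have hlam : lamVec X = h.eigenvalues ∘ τ := by
    unfold lamVec
    rw [dif_pos h]
    rfl
  refine ⟨V.submatrix id τ, ?_, ?_⟩
  · rw [Matrix.transpose_submatrix]
    ext i j
    have := congrFun (congrFun hV1 (τ i)) (τ j)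
    simpa [Matrix.mul_apply, Matrix.one_apply] using this
  · rw [hlam]
    conv_lhs => rw [hV2]
    ext i j
    rw [Matrix.mul_apply, Matrix.mul_apply]
    simp only [Matrix.mul_diagonal, Matrix.transpose_apply,
      Matrix.submatrix_apply, id, Function.comp]
    exact (Equiv.sum_comp τ (fun x => V i x * h.eigenvalues x * V j x)).symm

lemma pwa_le {n p : ℕ} [NeZero p] (a : Fin p → Fin n → ℝ) (c : Fin p → ℝ) (x : Fin n → ℝ)
    (i : Fin p) : a i ⬝ᵥ x - c i ≤ pwa a c x :=
  le_ciSup (f := fun i => a i ⬝ᵥ x - c i) (Set.finite_range _).bddAbove i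

lemma pwa_convex {n p : ℕ} [NeZero p] (a : Fin p → Fin n → ℝ) (c : Fin p → ℝ) {ι : Type*}
    [Fintype ι] (w : ι → ℝ) (hw : ∀ k, 0 ≤ w k) (hw1 : ∑ k, w k = 1) (x : ι → Fin n → ℝ) :
    pwa a c (∑ k, w k • x k) ≤ ∑ k, w k * pwa a c (x k) := by
  apply ciSup_le
  intro i
  have : a i ⬝ᵥ (∑ k, w k • x k) - c i = ∑ k, w k * (a i ⬝ᵥ x k - c i) := by
    rw [dotProduct_sum]
    simp only [dotProduct_smul, smul_eq_mul, mul_sub, Finset.sum_sub_distrib, ← Finset.sum_mul,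
      hw1, one_mul]
  rw [this]
  exact Finset.sum_le_sum fun k _ => mul_le_mul_of_nonneg_left (pwa_le a c _ i) (hw k)

lemma pwa_convex2 {n p : ℕ} [NeZero p] (a : Fin p → Fin n → ℝ) (c : Fin p → ℝ) (s t : ℝ)
    (hs : 0 ≤ s) (ht : 0 ≤ t) (hst : s + t = 1) (x y : Fin n → ℝ) :
    pwa a c (s • x + t • y) ≤ s * pwa a c x + t * pwa a c y := by
  have := pwa_convex a c ![s, t] (by intro k; fin_cases k <;> simpa) (by simpa using hst) ![x, y]
  simpa using this

lemma pwa_diag_le {n p : ℕ} [NeZero p] (a : Fin p → Fin n → ℝ) (c : Fin p → ℝ)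
    (hsym : ∀ (σ : Equiv.Perm (Fin n)) (x : Fin n → ℝ), pwa a c (x ∘ σ) = pwa a c x)
    (X V : Matrix (Fin n) (Fin n) ℝ) (hX : X.IsSymm) (hV : Vᵀ * V = 1) :
    pwa a c (fun i => (Vᵀ * X * V) i i) ≤ pwa a c (lamVec X) := by
  obtain ⟨U, hU1, hU2⟩ := OSet_nonempty X hX
  have hU1' : U * Uᵀ = 1 := mul_eq_one_comm.mp hU1
  have hV' : V * Vᵀ = 1 := mul_eq_one_comm.mp hV
  set O := Vᵀ * U with hO
  have hOt : Oᵀ = Uᵀ * V := by simp [hO]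
  have hO1 : O * Oᵀ = 1 := by
    rw [hOt, hO, Matrix.mul_assoc, ← Matrix.mul_assoc U, hU1', Matrix.one_mul, hV]
  have hO2 : Oᵀ * O = 1 := mul_eq_one_comm.mp hO1
  let M : Matrix (Fin n) (Fin n) ℝ := Matrix.of fun i j => O i j ^ 2
  have hM : M ∈ doublyStochastic ℝ (Fin n) := by
    rw [mem_doublyStochastic_iff_sum]
    refine ⟨fun i j => sq_nonneg _, fun i => ?_, fun j => ?_⟩
    · have := congrFun (congrFun hO1 i) i
      simpa [Matrix.mul_apply, M, sq] using this
    · have := congrFun (congrFun hO2 j) j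
      simpa [Matrix.mul_apply, M, sq] using this
  obtain ⟨w, hw0, hw1, hwM⟩ := exists_eq_sum_perm_of_mem_doublyStochastic hM
  have key : (fun i => (Vᵀ * X * V) i i) = ∑ σ, w σ • (lamVec X ∘ σ) := by
    have e1 : Vᵀ * X * V = O * Matrix.diagonal (lamVec X) * Oᵀ := by
      conv_lhs => rw [hU2]
      rw [hOt, hO]
      simp only [Matrix.mul_assoc]
    rw [e1]
    have e2 : (fun i => (O * Matrix.diagonal (lamVec X) * Oᵀ) i i) = M *ᵥ (lamVec X) := by
      ext i
      rw [Matrix.mul_apply]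
      simp only [Matrix.mul_diagonal, Matrix.transpose_apply,
        Matrix.mulVec, dotProduct, M, Matrix.of_apply]
      exact Finset.sum_congr rfl fun j _ => by ring
    rw [e2, ← hwM, Matrix.sum_mulVec]
    refine Finset.sum_congr rfl fun σ _ => ?_
    rw [Matrix.smul_mulVec, Matrix.permMatrix_mulVec]
  rw [key]
  refine (pwa_convex a c w hw0 hw1 _).trans ?_
  simp only [hsym, ← Finset.sum_mul, hw1, one_mul, le_refl]

lemma pwa_diag_eq {n p : ℕ} [NeZero p] (a : Fin p → Fin n → ℝ) (c : Fin p → ℝ)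
    (X : Matrix (Fin n) (Fin n) ℝ) (hX : X.IsSymm) :
    ∃ V : Matrix (Fin n) (Fin n) ℝ, Vᵀ * V = 1 ∧
      pwa a c (fun i => (Vᵀ * X * V) i i) = pwa a c (lamVec X) := by
  obtain ⟨U, hU1, hU2⟩ := OSet_nonempty X hX
  refine ⟨U, hU1, ?_⟩
  congr 1
  have : Uᵀ * X * U = Matrix.diagonal (lamVec X) := by
    conv_lhs => rw [hU2]
    calc Uᵀ * (U * Matrix.diagonal (lamVec X) * Uᵀ) * U
        = (Uᵀ * U) * Matrix.diagonal (lamVec X) * (Uᵀ * U) := by simp only [Matrix.mul_assoc]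
      _ = _ := by rw [hU1]; simp
  rw [this]
  ext i
  simp

/-- Convexity of a function on the symmetric matrices. -/
def SymConvex {n : ℕ} (f : Matrix (Fin n) (Fin n) ℝ → ℝ) : Prop :=
  ∀ X Y : Matrix (Fin n) (Fin n) ℝ, X.IsSymm → Y.IsSymm → ∀ s t : ℝ, 0 ≤ s → 0 ≤ t → s + t = 1 →
    f (s • X + t • Y) ≤ s * f X + t * f Y

lemma theta_convex {n p : ℕ} [NeZero p] (a : Fin p → Fin n → ℝ) (c : Fin p → ℝ)
    (hsym : ∀ (σ : Equiv.Perm (Fin n)) (x : Fin n → ℝ), pwa a c (x ∘ σ) = pwa a c x) :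
    SymConvex (n := n) (fun X => pwa a c (lamVec X)) := by
  intro X Y hX hY s t hs ht hst
  have hXY : (s • X + t • Y).IsSymm := (hX.smul s).add (hY.smul t)
  obtain ⟨V, hV, hVe⟩ := pwa_diag_eq a c _ hXY
  simp only
  rw [← hVe]
  have : (fun i => (Vᵀ * (s • X + t • Y) * V) i i)
      = s • (fun i => (Vᵀ * X * V) i i) + t • (fun i => (Vᵀ * Y * V) i i) := by
    ext i
    simp [Matrix.mul_add, Matrix.add_mul]
  rw [this]
  refine (pwa_convex2 a c s t hs ht hst _ _).trans ?_
  have h1 := pwa_diag_le a c hsym X V hX hV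
  have h2 := pwa_diag_le a c hsym Y V hY hV
  gcongr

section mipLemmas
variable {n : ℕ} (A B C : Matrix (Fin n) (Fin n) ℝ)

lemma mip_eq : mip A B = ∑ i, ∑ j, A i j * B i j := by
  unfold mip
  rw [Matrix.trace, Finset.sum_comm]
  refine Finset.sum_congr rfl fun i _ => ?_
  simp [Matrix.mul_apply]

lemma mip_comm : mip A B = mip B A := by
  simp only [mip_eq, mul_comm]

lemma mip_add_left : mip (A + B) C = mip A C + mip B C := by
  simp only [mip_eq, Matrix.add_apply, add_mul, Finset.sum_add_distrib]

lemma mip_add_right : mip C (A + B) = mip C A + mip C B := by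
  simp only [mip_eq, Matrix.add_apply, mul_add, Finset.sum_add_distrib]

lemma mip_sub_left : mip (A - B) C = mip A C - mip B C := by
  simp only [mip_eq, Matrix.sub_apply, sub_mul, Finset.sum_sub_distrib]

lemma mip_sub_right : mip C (A - B) = mip C A - mip C B := by
  simp only [mip_eq, Matrix.sub_apply, mul_sub, Finset.sum_sub_distrib]

lemma mip_smul_left (t : ℝ) : mip (t • A) B = t * mip A B := by
  simp only [mip_eq, Matrix.smul_apply, smul_eq_mul, Finset.mul_sum, mul_assoc]

lemma mip_smul_right (t : ℝ) : mip A (t • B) = t * mip A B := by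
  rw [mip_comm, mip_smul_left, mip_comm]

lemma mip_neg_right : mip A (-B) = -mip A B := by
  simp only [mip_eq, Matrix.neg_apply, mul_neg, Finset.sum_neg_distrib]

lemma mip_transpose : mip Aᵀ Bᵀ = mip A B := by
  simp only [mip_eq, Matrix.transpose_apply]
  rw [Finset.sum_comm]

lemma mip_self_nonneg : 0 ≤ mip A A := by
  rw [mip_eq]
  exact Finset.sum_nonneg fun i _ => Finset.sum_nonneg fun j _ => mul_self_nonneg _

lemma sq_le_mip_self (i j : Fin n) : A i j ^ 2 ≤ mip A A := by
  rw [mip_eq, sq]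
  refine le_trans ?_ (Finset.single_le_sum (f := fun i => ∑ j, A i j * A i j)
    (fun i _ => Finset.sum_nonneg fun j _ => mul_self_nonneg _) (Finset.mem_univ i))
  exact Finset.single_le_sum (f := fun j => A i j * A i j)
    (fun j _ => mul_self_nonneg _) (Finset.mem_univ j)

lemma mip_self_eq_zero (h : mip A A ≤ 0) : A = 0 := by
  ext i j
  have := (sq_le_mip_self A i j).trans h
  exact pow_eq_zero_iff (two_ne_zero) |>.mp (le_antisymm this (sq_nonneg _))

lemma mip_mul_left (R : Matrix (Fin n) (Fin n) ℝ) : mip (R * A) B = mip A (Rᵀ * B) := by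
  unfold mip
  rw [Matrix.transpose_mul, Matrix.mul_assoc]

lemma mip_mul_right (R : Matrix (Fin n) (Fin n) ℝ) : mip (A * R) B = mip A (B * Rᵀ) := by
  unfold mip
  rw [Matrix.transpose_mul, Matrix.mul_assoc, Matrix.trace_mul_comm, Matrix.mul_assoc]

lemma mip_conj (R : Matrix (Fin n) (Fin n) ℝ) (hR : Rᵀ * R = 1) :
    mip (R * A * Rᵀ) (R * B * Rᵀ) = mip A B := by
  rw [mip_mul_right, mip_mul_left]
  congr 1
  rw [Matrix.transpose_transpose]
  calc Rᵀ * (R * B * Rᵀ * R) = (Rᵀ * R) * B * (Rᵀ * R) := by simp only [Matrix.mul_assoc]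
    _ = B := by rw [hR]; simp

lemma mip_symm_skew (hA : A.IsSymm) (hB : Bᵀ = -B) : mip A B = 0 := by
  have := mip_transpose A B
  rw [hA.eq, hB, mip_neg_right] at this
  linarith

end mipLemmas

lemma continuous_mip {n : ℕ} {T : Type*} [TopologicalSpace T]
    {F G : T → Matrix (Fin n) (Fin n) ℝ} (hF : Continuous F) (hG : Continuous G) :
    Continuous fun t => mip (F t) (G t) := by
  unfold mip
  fun_prop

/-- The predicate of being a proximal point. -/
def IsProx {n : ℕ} (f : Matrix (Fin n) (Fin n) ℝ → ℝ) (X W : Matrix (Fin n) (Fin n) ℝ) : Prop :=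
  W.IsSymm ∧ ∀ U : Matrix (Fin n) (Fin n) ℝ, U.IsSymm →
    f W + mip (W - X) (W - X) / 2 ≤ f U + mip (U - X) (U - X) / 2

lemma isSymm_symmPart {n : ℕ} (X : Matrix (Fin n) (Fin n) ℝ) :
    ((1 / 2 : ℝ) • (X + Xᵀ)).IsSymm := by
  unfold Matrix.IsSymm
  rw [Matrix.transpose_smul, Matrix.transpose_add, Matrix.transpose_transpose, add_comm]

lemma symmPart_of_symm {n : ℕ} {X : Matrix (Fin n) (Fin n) ℝ} (hX : X.IsSymm) :
    ((1 / 2 : ℝ) • (X + Xᵀ)) = X := by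
  rw [hX.eq, ← two_smul ℝ X, smul_smul]
  norm_num

lemma IsProx.subgrad {n : ℕ} {f : Matrix (Fin n) (Fin n) ℝ → ℝ} (hf : SymConvex f)
    {Z W : Matrix (Fin n) (Fin n) ℝ} (h : IsProx f Z W) (V : Matrix (Fin n) (Fin n) ℝ)
    (hV : V.IsSymm) : f W + mip (Z - W) (V - W) ≤ f V := by
  by_contra hcon
  push Not at hcon
  set δ := f W + mip (Z - W) (V - W) - f V with hδ
  have hδ0 : 0 < δ := by linarith
  set q := mip (V - W) (V - W) with hq
  have hq0 : 0 ≤ q := mip_self_nonneg _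
  set t := δ / (q + δ) with ht
  have htq : t * (q + δ) = δ := by rw [ht]; field_simp
  have ht0 : 0 < t := by positivity
  have ht1 : t ≤ 1 := by rw [ht, div_le_one (by positivity)]; linarith
  have h1 := hf W V h.1 hV (1 - t) t (by linarith) ht0.le (by ring)
  have h2 := h.2 ((1 - t) • W + t • V) ((h.1.smul _).add (hV.smul _))
  have h3 : (1 - t) • W + t • V - Z = (W - Z) + t • (V - W) := by module
  have h4 : mip ((1 - t) • W + t • V - Z) ((1 - t) • W + t • V - Z)
      = mip (W - Z) (W - Z) + 2 * t * mip (W - Z) (V - W) + t ^ 2 * q := by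
    rw [h3, mip_add_left, mip_add_right, mip_add_right, mip_smul_left, mip_smul_left,
      mip_smul_right, mip_smul_right, mip_comm (V - W) (W - Z)]
    ring
  have h5 : mip (Z - W) (V - W) = - mip (W - Z) (V - W) := by
    simp only [mip_sub_left]; ring
  have h6 : t * δ ≤ t ^ 2 * q / 2 := by
    rw [h4] at h2
    rw [hδ, h5]
    nlinarith
  have h7 : δ ≤ t * q / 2 := by
    have : t * δ ≤ t * (t * q / 2) := by nlinarith
    exact le_of_mul_le_mul_left this ht0
  nlinarith [mul_nonneg ht0.le hq0, mul_pos ht0 hδ0]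

lemma IsProx.firm {n : ℕ} {f : Matrix (Fin n) (Fin n) ℝ → ℝ} (hf : SymConvex f)
    {Z W Z' W' : Matrix (Fin n) (Fin n) ℝ} (h : IsProx f Z W) (h' : IsProx f Z' W') :
    mip (W - W') (W - W') ≤ mip (W - W') (Z - Z') := by
  have h1 := h.subgrad hf W' h'.1
  have h2 := h'.subgrad hf W h.1
  simp only [mip_sub_left, mip_sub_right] at *
  rw [mip_comm Z W, mip_comm Z W', mip_comm W' W] at *
  rw [mip_comm Z' W, mip_comm Z' W'] at *
  linarith

lemma IsProx.uniq {n : ℕ} {f : Matrix (Fin n) (Fin n) ℝ → ℝ} (hf : SymConvex f)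
    {Z W W' : Matrix (Fin n) (Fin n) ℝ} (h : IsProx f Z W) (h' : IsProx f Z W') : W = W' := by
  have h1 := h.firm hf h'
  rw [sub_self Z] at h1
  have : mip (W - W') 0 = 0 := by simp [mip]
  rw [this] at h1
  exact sub_eq_zero.mp (mip_self_eq_zero _ h1)

lemma IsProx.conj {n : ℕ} {f : Matrix (Fin n) (Fin n) ℝ → ℝ}
    (hc : ∀ R X : Matrix (Fin n) (Fin n) ℝ, Rᵀ * R = 1 → X.IsSymm → f (R * X * Rᵀ) = f X)
    {Z W : Matrix (Fin n) (Fin n) ℝ} (h : IsProx f Z W)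
    (R : Matrix (Fin n) (Fin n) ℝ) (hR : Rᵀ * R = 1) : IsProx f (R * Z * Rᵀ) (R * W * Rᵀ) := by
  have hR' : R * Rᵀ = 1 := mul_eq_one_comm.mp hR
  have hs : ∀ (R V : Matrix (Fin n) (Fin n) ℝ), V.IsSymm → (R * V * Rᵀ).IsSymm := by
    intro R V hV
    unfold Matrix.IsSymm
    rw [Matrix.transpose_mul, Matrix.transpose_mul, hV.eq, Matrix.transpose_transpose,
      Matrix.mul_assoc]
  refine ⟨hs R W h.1, fun U hU => ?_⟩
  have hU' : (Rᵀ * U * R).IsSymm := by simpa using hs Rᵀ U hU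
  have hUe : U = R * (Rᵀ * U * R) * Rᵀ := by
    calc U = (R * Rᵀ) * U * (R * Rᵀ) := by rw [hR']; simp
      _ = _ := by simp only [Matrix.mul_assoc]
  have h1 := h.2 _ hU'
  rw [hUe, hc R W hR h.1, hc R _ hR hU', ← Matrix.sub_mul, ← Matrix.mul_sub, ← Matrix.sub_mul,
    ← Matrix.mul_sub, mip_conj _ _ R hR, mip_conj _ _ R hR]
  exact h1

lemma isProx_of_subgrad {n : ℕ} {f : Matrix (Fin n) (Fin n) ℝ → ℝ}
    {X Y : Matrix (Fin n) (Fin n) ℝ} (hX : X.IsSymm) (hY : Y ∈ msubdiff f X) :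
    IsProx f (X + Y) X := by
  refine ⟨hX, fun U hU => ?_⟩
  have h1 := hY.2 U hU
  have h2 := mip_self_nonneg (U - X)
  have h3 : U - (X + Y) = (U - X) - Y := by abel
  have h4 : X - (X + Y) = - Y := by abel
  have h5 : mip (-Y) (-Y) = mip Y Y := by rw [mip_neg_right, mip_comm, mip_neg_right, neg_neg]
  rw [h3, h4, h5, mip_sub_left, mip_sub_right (U - X) Y (U - X), mip_sub_right (U - X) Y Y,
    mip_comm (U - X) Y]
  linarith

lemma isProx_symmPart {n : ℕ} (f : Matrix (Fin n) (Fin n) ℝ → ℝ)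
    (Z W : Matrix (Fin n) (Fin n) ℝ) : IsProx f Z W ↔ IsProx f ((1 / 2 : ℝ) • (Z + Zᵀ)) W := by
  set Y := (1 / 2 : ℝ) • (Z + Zᵀ) with hY
  have key : ∀ U : Matrix (Fin n) (Fin n) ℝ, U.IsSymm →
      mip (U - Z) (U - Z) = mip (U - Y) (U - Y) + mip (Y - Z) (Y - Z) := by
    intro U hU
    have h1 : U - Z = (U - Y) + (Y - Z) := by abel
    have h2 : mip (U - Y) (Y - Z) = 0 := by
      apply mip_symm_skew
      · exact hU.sub (isSymm_symmPart Z)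
      · rw [Matrix.transpose_sub, (isSymm_symmPart Z).eq, hY]
        module
    rw [h1, mip_add_left, mip_add_right, mip_add_right, mip_comm (Y - Z) (U - Y), h2]
    ring
  constructor
  · rintro ⟨h1, h2⟩
    refine ⟨h1, fun U hU => ?_⟩
    have := h2 U hU
    rw [key U hU, key W h1] at this
    linarith
  · rintro ⟨h1, h2⟩
    refine ⟨h1, fun U hU => ?_⟩
    have := h2 U hU
    rw [key U hU, key W h1]
    linarith

lemma exists_isProx {n : ℕ} {f : Matrix (Fin n) (Fin n) ℝ → ℝ} (hf : SymConvex f)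
    {X Y : Matrix (Fin n) (Fin n) ℝ} (hX : X.IsSymm) (hY : Y ∈ msubdiff f X)
    (Z : Matrix (Fin n) (Fin n) ℝ) : ∃ W, IsProx f Z W := by
  have hcont : Continuous fun W : Matrix (Fin n) (Fin n) ℝ => f ((1 / 2 : ℝ) • (W + Wᵀ)) := by
    have hcv : ConvexOn ℝ Set.univ
        fun W : Matrix (Fin n) (Fin n) ℝ => f ((1 / 2 : ℝ) • (W + Wᵀ)) := by
      refine ⟨convex_univ, fun A _ B _ s t hs ht hst => ?_⟩
      have := hf _ _ (isSymm_symmPart A) (isSymm_symmPart B) s t hs ht hst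
      simp only [smul_eq_mul]
      have e : (1 / 2 : ℝ) • (s • A + t • B + (s • A + t • B)ᵀ)
          = s • (1 / 2 : ℝ) • (A + Aᵀ) + t • (1 / 2 : ℝ) • (B + Bᵀ) := by
        rw [Matrix.transpose_add, Matrix.transpose_smul, Matrix.transpose_smul]
        module
      rw [e]
      exact this
    exact continuousOn_univ.mp (hcv.continuousOn isOpen_univ)
  let G : Matrix (Fin n) (Fin n) ℝ → ℝ := fun U =>
    f X + mip Y (U - X) + mip (U - Z) (U - Z) / 2
  have hGc : Continuous G := by
    have h1 : Continuous fun U : Matrix (Fin n) (Fin n) ℝ => mip Y (U - X) :=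
      continuous_mip (by fun_prop) (by fun_prop)
    have h2 : Continuous fun U : Matrix (Fin n) (Fin n) ℝ => mip (U - Z) (U - Z) :=
      continuous_mip (by fun_prop) (by fun_prop)
    exact (continuous_const.add h1).add (h2.div_const 2)
  let b := f X + mip (X - Z) (X - Z) / 2
  let K : Set (Matrix (Fin n) (Fin n) ℝ) := {U | U.IsSymm ∧ G U ≤ b}
  have hKc : IsClosed K := by
    apply IsClosed.inter
    · exact isClosed_eq (by fun_prop) continuous_id
    · exact isClosed_le hGc continuous_const
  have hKb : Bornology.IsBounded K := by
    let C := 2 * (b - (f X - mip Y X + mip Y Z - mip Y Y / 2))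
    have hKC : ∀ U ∈ K, mip (U - (Z - Y)) (U - (Z - Y)) ≤ C := by
      rintro U ⟨_, hU⟩
      have e : G U = f X - mip Y X + mip Y Z - mip Y Y / 2
          + mip (U - (Z - Y)) (U - (Z - Y)) / 2 := by
        simp only [G, mip_sub_left, mip_sub_right, mip_comm U Y, mip_comm Z Y, mip_comm Z U]
        ring
      simp only [C]
      linarith
    refine (Metric.isBounded_closedBall (x := Z - Y) (r := Real.sqrt C)).subset ?_
    intro U hU
    rw [Metric.mem_closedBall, dist_eq_norm, Matrix.norm_le_iff (Real.sqrt_nonneg _)]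
    intro i j
    exact Real.abs_le_sqrt ((sq_le_mip_self _ i j).trans (hKC U hU))
  have hK : IsCompact K := Metric.isCompact_of_isClosed_isBounded hKc hKb
  have hXK : X ∈ K := ⟨hX, by simp [G, b, mip]⟩
  have hobj : Continuous fun U : Matrix (Fin n) (Fin n) ℝ =>
      f ((1 / 2 : ℝ) • (U + Uᵀ)) + mip (U - Z) (U - Z) / 2 :=
    hcont.add ((continuous_mip (by fun_prop) (by fun_prop)).div_const 2)
  obtain ⟨W, hWK, hW⟩ := hK.exists_isMinOn ⟨X, hXK⟩ hobj.continuousOn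
  have hmin : ∀ U ∈ K, f W + mip (W - Z) (W - Z) / 2 ≤ f U + mip (U - Z) (U - Z) / 2 := by
    intro U hU
    have := hW hU
    simp only [Set.mem_ofPred_eq] at this
    rwa [symmPart_of_symm hWK.1, symmPart_of_symm hU.1] at this
  refine ⟨W, hWK.1, fun U hU => ?_⟩
  by_cases hUK : U ∈ K
  · exact hmin U hUK
  · have h1 : b < G U := by
      by_contra hcon
      exact hUK ⟨hU, not_lt.mp hcon⟩
    have h2 := hY.2 U hU
    have h3 := hmin X hXK
    simp only [G, b] at h1
    linarith

/-- The properties of the function needed below. -/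
structure GoodFun {n : ℕ} (f : Matrix (Fin n) (Fin n) ℝ → ℝ) : Prop where
  conv : SymConvex f
  conj : ∀ R X : Matrix (Fin n) (Fin n) ℝ, Rᵀ * R = 1 → X.IsSymm → f (R * X * Rᵀ) = f X
  ex : ∀ Z, ∃ W, IsProx f Z W

namespace GoodFun
variable {n : ℕ} {f : Matrix (Fin n) (Fin n) ℝ → ℝ}

lemma spec (hf : GoodFun f) (Z : Matrix (Fin n) (Fin n) ℝ) : IsProx f Z (proxM f Z) :=
  Classical.epsilon_spec (hf.ex Z)

lemma eq_of (hf : GoodFun f) {Z W : Matrix (Fin n) (Fin n) ℝ} (h : IsProx f Z W) : proxM f Z = W :=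
  (hf.spec Z).uniq hf.conv h

lemma prox_symmPart (hf : GoodFun f) (Z : Matrix (Fin n) (Fin n) ℝ) :
    proxM f ((1 / 2 : ℝ) • (Z + Zᵀ)) = proxM f Z :=
  hf.eq_of ((isProx_symmPart f Z _).mp (hf.spec Z))

lemma prox_conj (hf : GoodFun f) (Z R : Matrix (Fin n) (Fin n) ℝ) (hR : Rᵀ * R = 1) :
    proxM f (R * Z * Rᵀ) = R * proxM f Z * Rᵀ :=
  hf.eq_of ((hf.spec Z).conj hf.conj R hR)

lemma firm (hf : GoodFun f) (Z Z' : Matrix (Fin n) (Fin n) ℝ) :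
    mip (proxM f Z - proxM f Z') (proxM f Z - proxM f Z')
      ≤ mip (proxM f Z - proxM f Z') (Z - Z') :=
  (hf.spec Z).firm hf.conv (hf.spec Z')

end GoodFun

lemma hasDerivAt_mat {n : ℕ} {F : ℝ → Matrix (Fin n) (Fin n) ℝ} {F' : Matrix (Fin n) (Fin n) ℝ}
    {t : ℝ} : HasDerivAt F F' t ↔ ∀ i j, HasDerivAt (fun s => F s i j) (F' i j) t := by
  constructor
  · intro h i j
    exact hasDerivAt_pi.mp (hasDerivAt_pi.mp h i) j
  · intro h
    exact hasDerivAt_pi.mpr fun i => hasDerivAt_pi.mpr fun j => h i j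

lemma hasDerivAt_matmul {n : ℕ} {F G : ℝ → Matrix (Fin n) (Fin n) ℝ}
    {F' G' : Matrix (Fin n) (Fin n) ℝ} {t : ℝ} (hF : HasDerivAt F F' t) (hG : HasDerivAt G G' t) :
    HasDerivAt (fun s => F s * G s) (F' * G t + F t * G') t := by
  rw [hasDerivAt_mat] at *
  intro i j
  simp only [Matrix.mul_apply, Matrix.add_apply, ← Finset.sum_add_distrib]
  exact HasDerivAt.fun_sum fun k _ => (hF i k).fun_mul (hG k j)

lemma hasDerivAt_mattranspose {n : ℕ} {F : ℝ → Matrix (Fin n) (Fin n) ℝ}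
    {F' : Matrix (Fin n) (Fin n) ℝ} {t : ℝ} (hF : HasDerivAt F F' t) :
    HasDerivAt (fun s => (F s)ᵀ) F'ᵀ t := by
  rw [hasDerivAt_mat] at *
  intro i j
  exact hF j i

lemma hasDerivAt_mip {n : ℕ} {F : ℝ → Matrix (Fin n) (Fin n) ℝ}
    {F' : Matrix (Fin n) (Fin n) ℝ} {t : ℝ} (hF : HasDerivAt F F' t)
    (C : Matrix (Fin n) (Fin n) ℝ) :
    HasDerivAt (fun s => mip (F s) C) (mip F' C) t := by
  rw [hasDerivAt_mat] at hF
  simp only [mip_eq]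
  exact HasDerivAt.fun_sum fun i _ => HasDerivAt.fun_sum fun j _ => (hF i j).mul_const _

open scoped Matrix.Norms.Operator in
lemma hasDerivAt_exp_entry {n : ℕ} (A : Matrix (Fin n) (Fin n) ℝ) (i j : Fin n) :
    HasDerivAt (fun t : ℝ => (NormedSpace.exp (t • A)) i j) (A i j) 0 := by
  have h := hasDerivAt_exp_smul_const (𝕂 := ℝ) A 0
  rw [zero_smul, NormedSpace.exp_zero, one_mul] at h
  let ev : Matrix (Fin n) (Fin n) ℝ →ₗ[ℝ] ℝ := Matrix.entryLinearMap ℝ ℝ i j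
  exact (LinearMap.toContinuousLinearMap ev).hasFDerivAt.comp_hasDerivAt (0 : ℝ) h

lemma hasDerivAt_exp_mat {n : ℕ} (A : Matrix (Fin n) (Fin n) ℝ) :
    HasDerivAt (fun t : ℝ => NormedSpace.exp (t • A)) A 0 :=
  hasDerivAt_mat.mpr fun i j => hasDerivAt_exp_entry A i j

lemma exp_orth {n : ℕ} (A : Matrix (Fin n) (Fin n) ℝ) (hA : Aᵀ = -A) (t : ℝ) :
    (NormedSpace.exp (t • A))ᵀ * NormedSpace.exp (t • A) = 1 := by
  rw [← Matrix.exp_transpose, Matrix.transpose_smul, hA, ← Matrix.exp_add_of_commute]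
  · rw [smul_neg, neg_add_cancel, NormedSpace.exp_zero]
  · rw [smul_neg]
    exact (Commute.refl _).neg_left

lemma hasDerivAt_rot {n : ℕ} (A Z : Matrix (Fin n) (Fin n) ℝ) (hA : Aᵀ = -A) :
    HasDerivAt (fun t : ℝ => NormedSpace.exp (t • A) * Z * (NormedSpace.exp (t • A))ᵀ)
      (A * Z - Z * A) 0 := by
  have h1 := hasDerivAt_exp_mat A
  have h2 := hasDerivAt_matmul (hasDerivAt_matmul h1 (hasDerivAt_const (0 : ℝ) Z))
    (hasDerivAt_mattranspose h1)
  convert h2 using 1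
  simp [hA, NormedSpace.exp_zero, sub_eq_add_neg]

/-- Properties of the (limiting) Jacobians of the proximal mapping. -/
structure JacProp {n : ℕ} (X Z : Matrix (Fin n) (Fin n) ℝ)
    (L : Matrix (Fin n) (Fin n) ℝ →L[ℝ] Matrix (Fin n) (Fin n) ℝ) : Prop where
  symm : ∀ H : Matrix (Fin n) (Fin n) ℝ, H.IsSymm → (L H)ᵀ = L H
  comm : ∀ H : Matrix (Fin n) (Fin n) ℝ, H.IsSymm → L H * Z + X * H = Z * L H + H * X
  rot : ∀ A : Matrix (Fin n) (Fin n) ℝ, Aᵀ = -A → L (A * Z - Z * A) = A * X - X * A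
  mono : ∀ H : Matrix (Fin n) (Fin n) ℝ, H.IsSymm → mip (L H) (L H) ≤ mip (L H) H

namespace GoodFun
variable {n : ℕ} {f : Matrix (Fin n) (Fin n) ℝ → ℝ}

lemma prox_comm (hf : GoodFun f) (Z : Matrix (Fin n) (Fin n) ℝ) (hZ : Z.IsSymm) :
    proxM f Z * Z = Z * proxM f Z := by
  have hX := hf.spec Z
  set X := proxM f Z
  set A := X * Z - Z * X with hAdef
  have hA : Aᵀ = -A := by
    rw [hAdef, Matrix.transpose_sub, Matrix.transpose_mul, Matrix.transpose_mul, hZ.eq, hX.1.eq]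
    abel
  have h1 := hasDerivAt_mip (hasDerivAt_rot A X hA) Z
  have hmax : IsLocalMax (fun t : ℝ =>
      mip (NormedSpace.exp (t • A) * X * (NormedSpace.exp (t • A))ᵀ) Z) 0 := by
    refine Filter.Eventually.of_forall fun t => ?_
    simp only [zero_smul, NormedSpace.exp_zero, Matrix.transpose_one, Matrix.one_mul,
      Matrix.mul_one]
    have hR := exp_orth A hA t
    set R := NormedSpace.exp (t • A)
    have hs : (R * X * Rᵀ).IsSymm := by
      unfold Matrix.IsSymm
      rw [Matrix.transpose_mul, Matrix.transpose_mul, hX.1.eq, Matrix.transpose_transpose,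
        Matrix.mul_assoc]
    have h2 := hX.2 _ hs
    have h3 := mip_conj X X R hR
    rw [hf.conj R X hR hX.1] at h2
    simp only [mip_sub_left, mip_sub_right, h3, mip_comm Z] at h2
    linarith
  have h2 := hmax.hasDerivAt_eq_zero h1
  rw [mip_sub_left, mip_mul_right, mip_mul_left, hX.1.eq, ← mip_sub_right] at h2
  have h3 : Z * X - X * Z = -A := by rw [hAdef]; abel
  rw [h3, mip_neg_right] at h2
  exact sub_eq_zero.mp (mip_self_eq_zero A (by linarith))

lemma jac_of_fderiv (hf : GoodFun f) (Z : Matrix (Fin n) (Fin n) ℝ) (hZ : Z.IsSymm)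
    (L : Matrix (Fin n) (Fin n) ℝ →L[ℝ] Matrix (Fin n) (Fin n) ℝ)
    (hL : HasFDerivAt (proxM f) L Z) : JacProp (proxM f Z) Z L := by
  have hline : ∀ H : Matrix (Fin n) (Fin n) ℝ, HasDerivAt (fun t : ℝ => Z + t • H) H 0 := by
    intro H
    refine hasDerivAt_mat.mpr fun i j => ?_
    have := ((hasDerivAt_id (0 : ℝ)).mul_const (H i j)).const_add (Z i j)
    simp only [id, one_mul] at this
    exact this
  have hdir : ∀ H : Matrix (Fin n) (Fin n) ℝ,
      HasDerivAt (fun t : ℝ => proxM f (Z + t • H)) (L H) 0 := by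
    intro H
    have hL' : HasFDerivAt (proxM f) L ((fun t : ℝ => Z + t • H) 0) := by simpa using hL
    exact hL'.comp_hasDerivAt (0 : ℝ) (hline H)
  refine ⟨fun H hH => ?_, fun H hH => ?_, fun A hA => ?_, fun H hH => ?_⟩
  · have h1 := hasDerivAt_mattranspose (hdir H)
    have h2 : (fun t : ℝ => (proxM f (Z + t • H))ᵀ) = fun t : ℝ => proxM f (Z + t • H) := by
      funext t
      exact (hf.spec _).1
    rw [h2] at h1
    exact h1.unique (hdir H)
  · have h1 := hasDerivAt_matmul (hdir H) (hline H)
    have h2 := hasDerivAt_matmul (hline H) (hdir H)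
    have h3 : (fun t : ℝ => proxM f (Z + t • H) * (Z + t • H))
        = fun t : ℝ => (Z + t • H) * proxM f (Z + t • H) := by
      funext t
      exact hf.prox_comm _ (hZ.add (hH.smul t))
    rw [h3] at h1
    have h4 := h1.unique h2
    simp only [zero_smul, add_zero] at h4
    rw [h4, add_comm]
  · have h1 := hasDerivAt_rot A Z hA
    have hL' : HasFDerivAt (proxM f) L
        ((fun t : ℝ => NormedSpace.exp (t • A) * Z * (NormedSpace.exp (t • A))ᵀ) 0) := by
      simpa [NormedSpace.exp_zero] using hL
    have h2 := hL'.comp_hasDerivAt (0 : ℝ) h1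
    have h3 : proxM f ∘ (fun t : ℝ => NormedSpace.exp (t • A) * Z * (NormedSpace.exp (t • A))ᵀ)
        = fun t : ℝ => NormedSpace.exp (t • A) * proxM f Z * (NormedSpace.exp (t • A))ᵀ := by
      funext t
      exact hf.prox_conj Z _ (exp_orth A hA t)
    rw [h3] at h2
    exact h2.unique (hasDerivAt_rot A _ hA)
  · have h1 := hasDerivAt_iff_tendsto_slope_zero.mp (hdir H)
    simp only [zero_add, zero_smul, add_zero] at h1
    have hc1 : Continuous fun D : Matrix (Fin n) (Fin n) ℝ => mip D D :=
      continuous_mip continuous_id continuous_id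
    have hc2 : Continuous fun D : Matrix (Fin n) (Fin n) ℝ => mip D H :=
      continuous_mip continuous_id continuous_const
    refine le_of_tendsto_of_tendsto ((hc1.tendsto _).comp h1) ((hc2.tendsto _).comp h1) ?_
    filter_upwards [self_mem_nhdsWithin] with t ht
    have ht : t ≠ 0 := ht
    have h2 := hf.firm (Z + t • H) Z
    rw [add_sub_cancel_left, mip_smul_right] at h2
    simp only [Function.comp, mip_smul_left, mip_smul_right]
    have h3 : 0 ≤ (t⁻¹) ^ 2 := sq_nonneg _
    calc t⁻¹ * (t⁻¹ * _) = (t⁻¹) ^ 2 * _ := by rw [sq, mul_assoc]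
      _ ≤ (t⁻¹) ^ 2 * (t * _) := mul_le_mul_of_nonneg_left h2 h3
      _ = _ := by field_simp

lemma tendsto_prox (hf : GoodFun f) {u : ℕ → Matrix (Fin n) (Fin n) ℝ}
    {Z : Matrix (Fin n) (Fin n) ℝ} (hu : Tendsto u atTop (𝓝 Z)) :
    Tendsto (fun k => proxM f (u k)) atTop (𝓝 (proxM f Z)) := by
  have hb : ∀ V, mip (proxM f V - proxM f Z) (proxM f V - proxM f Z) ≤ mip (V - Z) (V - Z) := by
    intro V
    have h1 := hf.firm V Z
    have h2 := mip_self_nonneg (proxM f V - proxM f Z - (V - Z))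
    set p := proxM f V - proxM f Z
    set d := V - Z
    rw [mip_sub_left, mip_sub_right p d p, mip_sub_right p d d, mip_comm d p] at h2
    linarith
  have hlim : Tendsto (fun k => mip (u k - Z) (u k - Z)) atTop (𝓝 0) := by
    have hc : Continuous fun V : Matrix (Fin n) (Fin n) ℝ => mip (V - Z) (V - Z) :=
      continuous_mip (by fun_prop) (by fun_prop)
    have := (hc.tendsto Z).comp hu
    simpa [mip, Function.comp_def] using this
  refine tendsto_pi_nhds.mpr fun i => tendsto_pi_nhds.mpr fun j => ?_
  rw [tendsto_iff_dist_tendsto_zero]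
  have hs : Tendsto (fun k => Real.sqrt (mip (u k - Z) (u k - Z))) atTop (𝓝 0) := by
    have := (Real.continuous_sqrt.tendsto 0).comp hlim
    simpa [Function.comp_def] using this
  refine squeeze_zero (fun k => dist_nonneg) (fun k => ?_) hs
  rw [Real.dist_eq]
  exact Real.abs_le_sqrt ((sq_le_mip_self (proxM f (u k) - proxM f Z) i j).trans (hb _))

lemma jac_limit (hf : GoodFun f) {u : ℕ → Matrix (Fin n) (Fin n) ℝ}
    {Z : Matrix (Fin n) (Fin n) ℝ} (hZ : Z.IsSymm) (hu : Tendsto u atTop (𝓝 Z))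
    (hd : ∀ k, DifferentiableAt ℝ (proxM f) (u k))
    {L : Matrix (Fin n) (Fin n) ℝ →L[ℝ] Matrix (Fin n) (Fin n) ℝ}
    (hL : Tendsto (fun k => fderiv ℝ (proxM f) (u k)) atTop (𝓝 L)) :
    JacProp (proxM f Z) Z L := by
  let v : ℕ → Matrix (Fin n) (Fin n) ℝ := fun k => (1 / 2 : ℝ) • (u k + (u k)ᵀ)
  have hv : Tendsto v atTop (𝓝 Z) := by
    have hc : Continuous fun V : Matrix (Fin n) (Fin n) ℝ => (1 / 2 : ℝ) • (V + Vᵀ) := by fun_prop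
    have := (hc.tendsto Z).comp hu
    rwa [symmPart_of_symm hZ] at this
  have hvd : ∀ k, HasFDerivAt (proxM f) (fderiv ℝ (proxM f) (u k)) (v k) := by
    intro k
    have h1 : proxM f = fun N => proxM f (N + (u k - v k)) := by
      funext N
      rw [← hf.prox_symmPart N, ← hf.prox_symmPart (N + (u k - v k))]
      congr 1
      simp only [v, Matrix.transpose_add, Matrix.transpose_sub, Matrix.transpose_smul,
        Matrix.transpose_transpose]
      module
    have h2 : HasFDerivAt (proxM f) (fderiv ℝ (proxM f) (u k)) (v k + (u k - v k)) := by
      rw [add_sub_cancel]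
      exact (hd k).hasFDerivAt
    have h3 := (hasFDerivAt_comp_add_right (u k - v k)).mpr h2
    rw [← h1] at h3
    exact h3
  have hJ : ∀ k, JacProp (proxM f (v k)) (v k) (fderiv ℝ (proxM f) (u k)) := fun k =>
    hf.jac_of_fderiv (v k) (isSymm_symmPart _) _ (hvd k)
  have hP := hf.tendsto_prox hv
  have happly : ∀ {G : ℕ → Matrix (Fin n) (Fin n) ℝ} {B : Matrix (Fin n) (Fin n) ℝ},
      Tendsto G atTop (𝓝 B) →
      Tendsto (fun k => fderiv ℝ (proxM f) (u k) (G k)) atTop (𝓝 (L B)) := by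
    intro G B hG
    exact (isBoundedBilinearMap_apply.continuous.tendsto (L, B)).comp (hL.prodMk_nhds hG)
  have hLH : ∀ H, Tendsto (fun k => fderiv ℝ (proxM f) (u k) H) atTop (𝓝 (L H)) := fun H =>
    happly tendsto_const_nhds
  have hmul : ∀ {F G : ℕ → Matrix (Fin n) (Fin n) ℝ} {A B : Matrix (Fin n) (Fin n) ℝ},
      Tendsto F atTop (𝓝 A) → Tendsto G atTop (𝓝 B) →
      Tendsto (fun k => F k * G k) atTop (𝓝 (A * B)) := by
    intro F G A B h1 h2
    have hc : Continuous fun q : Matrix (Fin n) (Fin n) ℝ × Matrix (Fin n) (Fin n) ℝ =>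
      q.1 * q.2 := by fun_prop
    exact (hc.tendsto (A, B)).comp (h1.prodMk_nhds h2)
  refine ⟨fun H hH => ?_, fun H hH => ?_, fun A hA => ?_, fun H hH => ?_⟩
  · have hc : Continuous fun V : Matrix (Fin n) (Fin n) ℝ => Vᵀ := by fun_prop
    refine tendsto_nhds_unique ((hc.tendsto _).comp (hLH H)) ?_
    refine (hLH H).congr fun k => ?_
    exact ((hJ k).symm H hH).symm
  · refine tendsto_nhds_unique ((hmul (hLH H) hv).add (hmul hP tendsto_const_nhds)) ?_
    refine ((hmul hv (hLH H)).add (hmul tendsto_const_nhds hP)).congr fun k => ?_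
    exact ((hJ k).comm H hH).symm
  · refine tendsto_nhds_unique (happly
      ((hmul (tendsto_const_nhds (x := A)) hv).sub (hmul hv (tendsto_const_nhds (x := A))))) ?_
    refine ((hmul (tendsto_const_nhds (x := A)) hP).sub
      (hmul hP (tendsto_const_nhds (x := A)))).congr fun k => ?_
    exact ((hJ k).rot A hA).symm
  · have hc1 : Continuous fun D : Matrix (Fin n) (Fin n) ℝ => mip D D :=
      continuous_mip continuous_id continuous_id
    have hc2 : Continuous fun D : Matrix (Fin n) (Fin n) ℝ => mip D H :=
      continuous_mip continuous_id continuous_const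
    exact le_of_tendsto_of_tendsto' ((hc1.tendsto _).comp (hLH H)) ((hc2.tendsto _).comp (hLH H))
      fun k => (hJ k).mono H hH

lemma jac_convex (X Z : Matrix (Fin n) (Fin n) ℝ) : Convex ℝ {L | JacProp X Z L} := by
  intro L1 h1 L2 h2 s t hs ht hst
  have h1 : JacProp X Z L1 := h1
  have h2 : JacProp X Z L2 := h2
  have happ : ∀ H, (s • L1 + t • L2) H = s • L1 H + t • L2 H := fun H => rfl
  have hdec : ∀ M : Matrix (Fin n) (Fin n) ℝ, M = s • M + t • M := fun M => by
    rw [← add_smul, hst, one_smul]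
  refine ⟨fun H hH => ?_, fun H hH => ?_, fun A hA => ?_, fun H hH => ?_⟩
  · rw [happ, Matrix.transpose_add, Matrix.transpose_smul, Matrix.transpose_smul, h1.symm H hH,
      h2.symm H hH]
  · have e1 := h1.comm H hH
    have e2 := h2.comm H hH
    rw [happ, hdec (X * H), hdec (H * X)]
    calc (s • L1 H + t • L2 H) * Z + (s • (X * H) + t • (X * H))
        = s • (L1 H * Z + X * H) + t • (L2 H * Z + X * H) := by
          simp only [Matrix.add_mul, Matrix.smul_mul, smul_add]; abel
      _ = s • (Z * L1 H + H * X) + t • (Z * L2 H + H * X) := by rw [e1, e2]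
      _ = _ := by simp only [Matrix.mul_add, Matrix.mul_smul, smul_add]; abel
  · rw [happ, h1.rot A hA, h2.rot A hA, ← hdec]
  · have e1 := h1.mono H hH
    have e2 := h2.mono H hH
    have e3 := mip_self_nonneg (L1 H - L2 H)
    rw [happ]
    simp only [mip_add_left, mip_add_right, mip_smul_left, mip_smul_right, mip_sub_left,
      mip_sub_right, mip_comm (L2 H) (L1 H)] at *
    have ht' : t = 1 - s := by linarith
    subst ht'
    nlinarith [mul_le_mul_of_nonneg_left e1 hs, mul_le_mul_of_nonneg_left e2 ht,
      mul_nonneg (mul_nonneg hs ht) e3]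

lemma jac_clarke (hf : GoodFun f) {Z : Matrix (Fin n) (Fin n) ℝ} (hZ : Z.IsSymm)
    {S : Matrix (Fin n) (Fin n) ℝ →L[ℝ] Matrix (Fin n) (Fin n) ℝ}
    (hS : S ∈ clarkeJacobian (proxM f) Z) : JacProp (proxM f Z) Z S := by
  refine convexHull_min (t := {L | JacProp (proxM f Z) Z L}) ?_ (jac_convex _ _) hS
  rintro L ⟨u, hd, hu, hL⟩
  exact hf.jac_limit hZ hu hd hL

end GoodFun

lemma penrose_unique {n : ℕ} {A B C : Matrix (Fin n) (Fin n) ℝ}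
    (hB : A * B * A = A ∧ B * A * B = B ∧ (A * B)ᵀ = A * B ∧ (B * A)ᵀ = B * A)
    (hC : A * C * A = A ∧ C * A * C = C ∧ (A * C)ᵀ = A * C ∧ (C * A)ᵀ = C * A) : B = C := by
  obtain ⟨b1, b2, b3, b4⟩ := hB
  obtain ⟨c1, c2, c3, c4⟩ := hC
  have e1 : A * B = A * C := by
    calc A * B = (A * C * A) * B := by rw [c1]
      _ = (A * C) * (A * B) := by simp only [Matrix.mul_assoc]
      _ = (A * C)ᵀ * (A * B)ᵀ := by rw [c3, b3]
      _ = (A * B * (A * C))ᵀ := by rw [← Matrix.transpose_mul]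
      _ = (A * B * A * C)ᵀ := by simp only [Matrix.mul_assoc]
      _ = A * C := by rw [b1, c3]
  have e2 : B * A = C * A := by
    calc B * A = B * (A * C * A) := by rw [c1]
      _ = (B * A) * (C * A) := by simp only [Matrix.mul_assoc]
      _ = (B * A)ᵀ * (C * A)ᵀ := by rw [c4, b4]
      _ = (C * A * (B * A))ᵀ := by rw [← Matrix.transpose_mul]
      _ = (C * (A * B * A))ᵀ := by simp only [Matrix.mul_assoc]
      _ = C * A := by rw [b1, c4]
  calc B = B * A * B := b2.symm
    _ = C * A * B := by rw [e2]
    _ = C * (A * B) := by rw [Matrix.mul_assoc]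
    _ = C * A * C := by rw [e1, Matrix.mul_assoc]
    _ = C := c2

lemma conj_mul_conj {n : ℕ} {U : Matrix (Fin n) (Fin n) ℝ} (hU : Uᵀ * U = 1)
    (A B : Matrix (Fin n) (Fin n) ℝ) : (U * A * Uᵀ) * (U * B * Uᵀ) = U * (A * B) * Uᵀ := by
  calc (U * A * Uᵀ) * (U * B * Uᵀ) = U * A * (Uᵀ * U) * B * Uᵀ := by simp only [Matrix.mul_assoc]
    _ = _ := by rw [hU]; simp only [Matrix.mul_assoc, Matrix.one_mul]

lemma conj_transpose {n : ℕ} (U A : Matrix (Fin n) (Fin n) ℝ) :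
    (U * A * Uᵀ)ᵀ = U * Aᵀ * Uᵀ := by
  rw [Matrix.transpose_mul, Matrix.transpose_mul, Matrix.transpose_transpose, Matrix.mul_assoc]

lemma mpInv_conj_diag {n : ℕ} {U : Matrix (Fin n) (Fin n) ℝ} (hU : Uᵀ * U = 1) (w : Fin n → ℝ) :
    mpInv (U * Matrix.diagonal w * Uᵀ) = U * Matrix.diagonal (fun j => (w j)⁻¹) * Uᵀ := by
  have hC : (fun A B : Matrix (Fin n) (Fin n) ℝ =>
      A * B * A = A ∧ B * A * B = B ∧ (A * B)ᵀ = A * B ∧ (B * A)ᵀ = B * A)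
      (U * Matrix.diagonal w * Uᵀ) (U * Matrix.diagonal (fun j => (w j)⁻¹) * Uᵀ) := by
    have h1 : ∀ r : ℝ, r * r⁻¹ * r = r := fun r => by
      by_cases h : r = 0
      · simp [h]
      · field_simp
    have h2 : ∀ r : ℝ, r⁻¹ * r * r⁻¹ = r⁻¹ := fun r => by
      by_cases h : r = 0
      · simp [h]
      · field_simp
    simp only [conj_mul_conj hU, conj_transpose, Matrix.diagonal_mul_diagonal,
      Matrix.diagonal_transpose, h1, h2, and_self]
  exact penrose_unique (Classical.epsilon_spec (p := fun B =>
    (U * Matrix.diagonal w * Uᵀ) * B * (U * Matrix.diagonal w * Uᵀ) = (U * Matrix.diagonal w * Uᵀ)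
    ∧ B * (U * Matrix.diagonal w * Uᵀ) * B = B
    ∧ ((U * Matrix.diagonal w * Uᵀ) * B)ᵀ = (U * Matrix.diagonal w * Uᵀ) * B
    ∧ (B * (U * Matrix.diagonal w * Uᵀ))ᵀ = B * (U * Matrix.diagonal w * Uᵀ)) ⟨_, hC⟩) hC

lemma Upsilon_eq {n : ℕ} {X Y U D d : Matrix (Fin n) (Fin n) ℝ} (hU : Uᵀ * U = 1)
    (hX : X = U * Matrix.diagonal (lamVec X) * Uᵀ) (hd : d.IsSymm) (hD : D = U * d * Uᵀ) :
    -(Upsilon X Y U D) = ∑ i, ∑ j,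
      d i j ^ 2 * (lamVec Y i - lamVec Y j) * (lamVec X i - lamVec X j)⁻¹ := by
  have hU' : U * Uᵀ = 1 := mul_eq_one_comm.mp hU
  set x := lamVec X with hx
  set y := lamVec Y with hy
  have h1 : ∀ i, (Uᵀ * D * mpInv (X - x i • (1 : Matrix (Fin n) (Fin n) ℝ)) * D * U) i i
      = ∑ j, d i j ^ 2 * (x j - x i)⁻¹ := by
    intro i
    have e1 : X - x i • (1 : Matrix (Fin n) (Fin n) ℝ)
        = U * Matrix.diagonal (fun j => x j - x i) * Uᵀ := by
      have : Matrix.diagonal (fun j => x j - x i)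
          = Matrix.diagonal x - x i • (1 : Matrix (Fin n) (Fin n) ℝ) := by
        ext k l
        by_cases h : k = l
        · subst h; simp
        · simp [h]
      rw [this, Matrix.mul_sub, Matrix.sub_mul, ← hX, Matrix.mul_smul, Matrix.smul_mul,
        Matrix.mul_one, hU']
    rw [e1, mpInv_conj_diag hU, hD]
    have e2 : Uᵀ * (U * d * Uᵀ) * (U * Matrix.diagonal (fun j => (x j - x i)⁻¹) * Uᵀ)
        * (U * d * Uᵀ) * U = d * Matrix.diagonal (fun j => (x j - x i)⁻¹) * d := by
      rw [Matrix.mul_assoc Uᵀ, conj_mul_conj hU, Matrix.mul_assoc Uᵀ, conj_mul_conj hU]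
      calc Uᵀ * (U * (d * Matrix.diagonal (fun j => (x j - x i)⁻¹) * d) * Uᵀ) * U
          = (Uᵀ * U) * (d * Matrix.diagonal (fun j => (x j - x i)⁻¹) * d) * (Uᵀ * U) := by
            simp only [Matrix.mul_assoc]
        _ = _ := by rw [hU, Matrix.one_mul, Matrix.mul_one]
    rw [e2, Matrix.mul_apply]
    refine Finset.sum_congr rfl fun j _ => ?_
    rw [Matrix.mul_diagonal, hd.apply i j]
    ring
  unfold Upsilon
  simp only [← hx, ← hy, h1]
  have hT : ∑ i, y i * ∑ j, d i j ^ 2 * (x j - x i)⁻¹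
      = ∑ i, ∑ j, y i * (d i j ^ 2 * (x j - x i)⁻¹) := by
    simp only [Finset.mul_sum]
  have hT' : ∑ i, ∑ j, y i * (d i j ^ 2 * (x j - x i)⁻¹)
      = ∑ i, ∑ j, y j * (d i j ^ 2 * (x i - x j)⁻¹) := by
    rw [Finset.sum_comm]
    refine Finset.sum_congr rfl fun i _ => Finset.sum_congr rfl fun j _ => ?_
    rw [hd.apply i j]
  rw [hT, two_mul]
  conv_lhs => arg 1; arg 2; rw [hT']
  simp only [← Finset.sum_add_distrib, ← Finset.sum_neg_distrib]
  refine Finset.sum_congr rfl fun i _ => Finset.sum_congr rfl fun j _ => ?_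
  rw [← neg_sub (x i) (x j), inv_neg]
  ring

lemma final_ineq {n : ℕ} {X Y U DX DY : Matrix (Fin n) (Fin n) ℝ}
    {S : Matrix (Fin n) (Fin n) ℝ →L[ℝ] Matrix (Fin n) (Fin n) ℝ}
    (hJ : JacProp X (X + Y) S) (hDX : DX.IsSymm) (hDY : DY.IsSymm) (hfix : DX = S (DX + DY))
    (hUX : U ∈ OSet X) (hUY : U ∈ OSet Y) : mip DX DY ≥ -(Upsilon X Y U DX) := by
  obtain ⟨hU, hX⟩ := hUX
  obtain ⟨_, hY⟩ := hUY
  have hU' : U * Uᵀ = 1 := mul_eq_one_comm.mp hU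
  have hrep : ∀ M : Matrix (Fin n) (Fin n) ℝ, M = U * (Uᵀ * M * U) * Uᵀ := fun M => by
    calc M = (U * Uᵀ) * M * (U * Uᵀ) := by rw [hU']; simp
      _ = _ := by simp only [Matrix.mul_assoc]
  have hinj : ∀ M N : Matrix (Fin n) (Fin n) ℝ, U * M * Uᵀ = U * N * Uᵀ → M = N := by
    intro M N h
    have hc : ∀ M : Matrix (Fin n) (Fin n) ℝ, Uᵀ * (U * M * Uᵀ) * U = M := fun M => by
      calc Uᵀ * (U * M * Uᵀ) * U = (Uᵀ * U) * M * (Uᵀ * U) := by simp only [Matrix.mul_assoc]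
        _ = M := by rw [hU]; simp
    rw [← hc M, h, hc N]
  have hsymm : ∀ M : Matrix (Fin n) (Fin n) ℝ, M.IsSymm → (Uᵀ * M * U).IsSymm := by
    intro M hM
    unfold Matrix.IsSymm
    rw [Matrix.transpose_mul, Matrix.transpose_mul, hM.eq, Matrix.transpose_transpose,
      Matrix.mul_assoc]
  have hxa := lamVec_antitone X
  have hya := lamVec_antitone Y
  obtain ⟨d, hd, hdD⟩ : ∃ d : Matrix (Fin n) (Fin n) ℝ, d.IsSymm ∧ DX = U * d * Uᵀ :=
    ⟨_, hsymm _ hDX, hrep _⟩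
  obtain ⟨e, he, heD⟩ : ∃ e : Matrix (Fin n) (Fin n) ℝ, e.IsSymm ∧ DY = U * e * Uᵀ :=
    ⟨_, hsymm _ hDY, hrep _⟩
  rw [ge_iff_le, Upsilon_eq hU hX hd hdD]
  set x := lamVec X with hx
  set y := lamVec Y with hy
  let z : Fin n → ℝ := fun i => x i + y i
  have hzx : ∀ i j, z i = z j → x i = x j := by
    intro i j h
    simp only [z] at h
    rcases le_total i j with hij | hij
    · have h1 := hxa hij
      have h2 := hya hij
      linarith
    · have h1 := hxa hij
      have h2 := hya hij
      linarith
  have hZ : X + Y = U * Matrix.diagonal z * Uᵀ := by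
    have : Matrix.diagonal z = Matrix.diagonal x + Matrix.diagonal y := by
      rw [Matrix.diagonal_add]
    rw [this, Matrix.mul_add, Matrix.add_mul, ← hX, ← hY]
  let a : Matrix (Fin n) (Fin n) ℝ := Matrix.of fun i j =>
    if z i = z j then 0 else (d i j + e i j) / (z j - z i)
  let k : Matrix (Fin n) (Fin n) ℝ := Matrix.of fun i j =>
    if z i = z j then d i j + e i j else 0
  have haT : aᵀ = -a := by
    ext i j
    simp only [a, Matrix.transpose_apply, Matrix.of_apply, Matrix.neg_apply, hd.apply i j,
      he.apply i j]
    by_cases h : z i = z j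
    · simp [h]
    · rw [if_neg h, if_neg (Ne.symm h), ← neg_sub (z j) (z i), div_neg]
  have hkT : k.IsSymm := by
    ext i j
    simp only [k, Matrix.transpose_apply, Matrix.of_apply, hd.apply i j, he.apply i j,
      eq_comm (a := z j)]
  have hA : (U * a * Uᵀ)ᵀ = -(U * a * Uᵀ) := by
    rw [conj_transpose, haT, Matrix.mul_neg, Matrix.neg_mul]
  have hK : (U * k * Uᵀ).IsSymm := by
    unfold Matrix.IsSymm
    rw [conj_transpose, hkT.eq]
  obtain ⟨s, hs⟩ : ∃ s : Matrix (Fin n) (Fin n) ℝ, S (U * k * Uᵀ) = U * s * Uᵀ := ⟨_, hrep _⟩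
  have hdec : d + e = k + (a * Matrix.diagonal z - Matrix.diagonal z * a) := by
    ext i j
    simp only [Matrix.add_apply, Matrix.sub_apply, Matrix.mul_diagonal, Matrix.diagonal_mul, a, k,
      Matrix.of_apply]
    by_cases h : z i = z j
    · simp [h]
    · have : z j - z i ≠ 0 := sub_ne_zero.mpr (Ne.symm h)
      rw [if_neg h, if_neg h]
      field_simp
      ring
  have hd2 : d = s + (a * Matrix.diagonal x - Matrix.diagonal x * a) := by
    apply hinj
    have h1 : DX + DY = U * k * Uᵀ + ((U * a * Uᵀ) * (X + Y) - (X + Y) * (U * a * Uᵀ)) := by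
      rw [hZ, conj_mul_conj hU, conj_mul_conj hU, hdD, heD, ← Matrix.add_mul, ← Matrix.mul_add,
        hdec]
      simp only [Matrix.mul_add, Matrix.add_mul, Matrix.mul_sub, Matrix.sub_mul]
    rw [h1, map_add, hJ.rot _ hA, hs, hdD] at hfix
    rw [hfix, hX, conj_mul_conj hU, conj_mul_conj hU]
    simp only [Matrix.mul_add, Matrix.add_mul, Matrix.mul_sub, Matrix.sub_mul]
  have hcomm := hJ.comm _ hK
  rw [hs, hZ] at hcomm
  rw [hX, conj_mul_conj hU, conj_mul_conj hU, conj_mul_conj hU, conj_mul_conj hU,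
    ← Matrix.add_mul, ← Matrix.mul_add, ← Matrix.add_mul, ← Matrix.mul_add] at hcomm
  have hcomm := hinj _ _ hcomm
  have hmono := hJ.mono _ hK
  rw [hs, mip_conj _ _ U hU, mip_conj _ _ U hU, mip_eq, mip_eq] at hmono
  rw [hdD, heD, mip_conj _ _ U hU, mip_eq]
  have key : ∀ i j, d i j * e i j
      = d i j ^ 2 * (y i - y j) * (x i - x j)⁻¹ + (s i j * k i j - s i j * s i j) := by
    intro i j
    have e1 := congrFun (congrFun hd2 i) j
    have e2 := congrFun (congrFun hcomm i) j
    have e3 := congrFun (congrFun hdec i) j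
    simp only [Matrix.add_apply, Matrix.sub_apply, Matrix.mul_diagonal, Matrix.diagonal_mul]
      at e1 e2 e3
    by_cases h : z i = z j
    · have hk : k i j = d i j + e i j := by simp only [k, Matrix.of_apply, if_pos h]
      have ha : a i j = 0 := by simp only [a, Matrix.of_apply, if_pos h]
      have hxx := hzx i j h
      rw [ha] at e1
      have e1 : d i j = s i j := by linarith
      rw [hk, ← e1, hxx]
      simp
      ring
    · have hk : k i j = 0 := by simp only [k, Matrix.of_apply, if_neg h]
      rw [hk] at e2 e3
      have hs0 : s i j = 0 := by
        have : s i j * (z i - z j) = 0 := by linarith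
        rcases mul_eq_zero.mp this with h' | h'
        · exact h'
        · exact absurd (sub_eq_zero.mp h') h
      rw [hs0] at e1
      have e1 : d i j = a i j * (x j - x i) := by linarith
      have e4 : e i j = a i j * (y j - y i) := by
        simp only [z] at e3
        linarith
      rw [hs0, hk, e4, e1]
      by_cases hxx : x i = x j
      · simp [hxx]
      · have : x i - x j ≠ 0 := sub_ne_zero.mpr hxx
        field_simp
        ring
  simp only [key, Finset.sum_add_distrib, Finset.sum_sub_distrib]
  linarith

/-- Lemma 4.5.  For `Ȳ ∈ ∂θ₁(X̄)`, any `S ∈ ∂Pr_{θ₁}(X̄+Ȳ)` and any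
symmetric pair `(ΔX, ΔY)` with `ΔX = S(ΔX + ΔY)`, one has `⟨ΔX, ΔY⟩ ≥ -Υ¹_{X̄}(Ȳ, ΔX)`. -/
theorem stmt15 {n p : ℕ} [NeZero p]
    (a : Fin p → Fin n → ℝ) (c : Fin p → ℝ)
    (hsym : ∀ (σ : Equiv.Perm (Fin n)) (x : Fin n → ℝ), pwa a c (x ∘ σ) = pwa a c x)
    (theta1 : Matrix (Fin n) (Fin n) ℝ → ℝ)
    (htheta1 : theta1 = fun X => pwa a c (lamVec X))
    (Xb : Matrix (Fin n) (Fin n) ℝ) (hXb : Xb.IsSymm)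
    (Yb : Matrix (Fin n) (Fin n) ℝ) (hYb : Yb ∈ msubdiff theta1 Xb)
    (S : Matrix (Fin n) (Fin n) ℝ →L[ℝ] Matrix (Fin n) (Fin n) ℝ)
    (hS : S ∈ clarkeJacobian (proxM theta1) (Xb + Yb))
    (DX DY : Matrix (Fin n) (Fin n) ℝ) (hDX : DX.IsSymm) (hDY : DY.IsSymm)
    (hfix : DX = S (DX + DY)) :
    ∀ Ub ∈ OSet Xb ∩ OSet Yb, mip DX DY ≥ -(Upsilon Xb Yb Ub DX) := by
  subst htheta1
  have hf : GoodFun (n := n) (fun X => pwa a c (lamVec X)) := by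
    have hcv := theta_convex a c hsym
    refine ⟨hcv, fun R X hR hX => ?_, exists_isProx hcv hXb hYb⟩
    simp only [lamVec_conj R X hR hX]
  have hJ := hf.jac_clarke (hXb.add hYb.1) hS
  rw [hf.eq_of (isProx_of_subgrad hXb hYb)] at hJ
  rintro U ⟨hUX, hUY⟩
  exact final_ineq hJ hDX hDY hfix hUX hUY


end
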